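/- Under assumptions (A2) and (A4), for every T ≥ 1 and coordinate i ∈ [d], the AdaGrad iterates satisfy E[ln(1 + v_{T,i}/λ²)] ≤ 2 ln(1 + (√2·σ_i·T^{1/p} + E[√(2u_{T,i})])/λ) ≤ 2 ln K_T, where u_{T,i} = ∑_{t=1}^T (∇_i f(x_t))² and K_T = 1 + (√2·‖σ‖_∞·T^{1/p} + 2‖∇f(x₁)‖_∞·T^{1/2} + 2γ√(‖L‖₁‖L‖_∞)·T^{3/2})/λ. -/

import Mathlib

open MeasureTheory Finset

/-- The AdaGrad accumulator `v_{t,i} = ∑_{s=1}^t g_{s,i}²`. -/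
noncomputable def adaV {Ω : Type} {d : ℕ} (g : ℕ → Ω → EuclideanSpace ℝ (Fin d))
    (t : ℕ) (ω : Ω) (i : Fin d) : ℝ :=
  ∑ s ∈ Finset.Icc 1 t, (g s ω i) ^ 2

/-- The natural filtration `F_t = σ(g_1, …, g_t)`. -/
noncomputable def natFilt {Ω : Type} [MeasurableSpace Ω] {d : ℕ}
    (g : ℕ → Ω → EuclideanSpace ℝ (Fin d)) (t : ℕ) : MeasurableSpace Ω :=
  ⨆ s ∈ Finset.Icc 1 t, MeasurableSpace.comap (g s) inferInstance

/-- Two-sided coordinate-wise quadratic bounds make each partial derivative Lipschitz in the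
weighted Euclidean norm. -/
lemma sq_partial_sub_le_of_coordinate_smooth {d : ℕ} {f : EuclideanSpace ℝ (Fin d) → ℝ}
    {gradf : EuclideanSpace ℝ (Fin d) → EuclideanSpace ℝ (Fin d)} {L : Fin d → ℝ}
    (hL : ∀ i, 0 < L i)
    (hsmooth : ∀ u v : EuclideanSpace ℝ (Fin d),
      |f u - f v - ∑ i, gradf v i * (u i - v i)| ≤ 1 / 2 * ∑ i, L i * (u i - v i) ^ 2)
    (u v : EuclideanSpace ℝ (Fin d)) (i : Fin d) :
    (gradf u i - gradf v i) ^ 2 ≤ L i * ∑ j, L j * (u j - v j) ^ 2 := by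
  obtain ⟨s, hs⟩ : ∃ s : ℝ, s * (2 * L i) = gradf u i - gradf v i :=
    ⟨_, div_mul_cancel₀ _ (by linarith [hL i])⟩
  let e : Fin d → ℝ := Pi.single i s
  let z : EuclideanSpace ℝ (Fin d) := WithLp.toLp 2 fun j => (u j + v j) / 2 + e j
  let z' : EuclideanSpace ℝ (Fin d) := WithLp.toLp 2 fun j => (u j + v j) / 2 - e j
  have hz (j) : z j = (u j + v j) / 2 + e j := rfl
  have hz' (j) : z' j = (u j + v j) / 2 - e j := rfl
  have hcombined : ∑ j, (gradf u j * (z j - u j) - gradf v j * (z j - v j)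
        + gradf v j * (z' j - v j) - gradf u j * (z' j - u j)) ≤
      ∑ j, 1 / 2 * (L j * (z j - u j) ^ 2 + L j * (z j - v j) ^ 2
        + L j * (z' j - v j) ^ 2 + L j * (z' j - u j) ^ 2) := by
    have h₁ := (abs_le.mp (hsmooth z u)).1
    have h₂ := (abs_le.mp (hsmooth z v)).2
    have h₃ := (abs_le.mp (hsmooth z' v)).1
    have h₄ := (abs_le.mp (hsmooth z' u)).2
    simp only [Finset.sum_add_distrib, Finset.sum_sub_distrib, ← Finset.mul_sum]
    linarith
  have hleft : ∑ j, (gradf u j * (z j - u j) - gradf v j * (z j - v j)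
        + gradf v j * (z' j - v j) - gradf u j * (z' j - u j)) =
      2 * ((gradf u i - gradf v i) * s) := by
    rw [Finset.sum_eq_single i]
    · simp only [hz, hz', e, Pi.single_eq_same]; ring
    · intro j _ hj
      simp only [hz, hz', e, Pi.single_eq_of_ne hj]; ring
    · simp
  have hright : ∑ j, 1 / 2 * (L j * (z j - u j) ^ 2 + L j * (z j - v j) ^ 2
        + L j * (z' j - v j) ^ 2 + L j * (z' j - u j) ^ 2) =
      2 * (L i * s ^ 2) + 1 / 2 * ∑ j, L j * (u j - v j) ^ 2 := by
    have he : ∑ j, L j * e j ^ 2 = L i * s ^ 2 := by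
      rw [Finset.sum_eq_single i]
      · simp [e]
      · intro j _ hj
        simp [e, Pi.single_eq_of_ne hj]
      · simp
    rw [← he, Finset.mul_sum, Finset.mul_sum, ← Finset.sum_add_distrib]
    refine Finset.sum_congr rfl fun j _ => ?_
    simp only [hz, hz']; ring
  rw [hleft, hright, ← hs] at hcombined
  rw [← hs]
  nlinarith [hL i]

lemma continuous_partial_of_coordinate_smooth {d : ℕ} {f : EuclideanSpace ℝ (Fin d) → ℝ}
    {gradf : EuclideanSpace ℝ (Fin d) → EuclideanSpace ℝ (Fin d)} {L : Fin d → ℝ}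
    (hL : ∀ i, 0 < L i)
    (hsmooth : ∀ u v : EuclideanSpace ℝ (Fin d),
      |f u - f v - ∑ i, gradf v i * (u i - v i)| ≤ 1 / 2 * ∑ i, L i * (u i - v i) ^ 2)
    (i : Fin d) : Continuous fun y => gradf y i := by
  refine continuous_iff_continuousAt.mpr fun v => tendsto_iff_dist_tendsto_zero.mpr ?_
  have hbound : Continuous fun y : EuclideanSpace ℝ (Fin d) =>
      √(L i * ∑ j, L j * (y j - v j) ^ 2) := by fun_prop
  have hlim := hbound.tendsto v
  simp only [sub_self, ne_eq, OfNat.ofNat_ne_zero, not_false_eq_true, zero_pow, mul_zero,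
    Finset.sum_const_zero, Real.sqrt_zero] at hlim
  refine squeeze_zero (fun _ => dist_nonneg) (fun y => ?_) hlim
  rw [Real.dist_eq]
  exact Real.abs_le_sqrt (sq_partial_sub_le_of_coordinate_smooth hL hsmooth y v i)

/-- The `ℓ²` norm of a finite family is at most its `ℓᵖ` norm when `0 < p ≤ 2`. -/
lemma sqrt_sum_sq_le_rpow_sum_abs_rpow {ι : Type*} (s : Finset ι) (a : ι → ℝ) {p : ℝ}
    (hp : 0 < p) (hp2 : p ≤ 2) :
    √(∑ t ∈ s, a t ^ 2) ≤ (∑ t ∈ s, |a t| ^ p) ^ (1 / p) := by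
  set S := ∑ t ∈ s, |a t| ^ p with hS
  have hS0 : 0 ≤ S := Finset.sum_nonneg fun t _ => by positivity
  have hroot (t) (ht : t ∈ s) : |a t| ≤ S ^ (1 / p) := by
    have hle : |a t| ^ p ≤ S :=
      Finset.single_le_sum (f := fun t => |a t| ^ p) (fun t _ => by positivity) ht
    calc |a t| = (|a t| ^ p) ^ (1 / p) := by
          rw [one_div, Real.rpow_rpow_inv (abs_nonneg _) hp.ne']
      _ ≤ S ^ (1 / p) := by gcongr
  have hR : (S ^ (1 / p)) ^ p = S := by
    rw [one_div, Real.rpow_inv_rpow hS0 hp.ne']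
  have hsplit (y : ℝ) (hy : 0 ≤ y) : y ^ 2 = y ^ p * y ^ (2 - p) := by
    rw [← Real.rpow_add' hy (by norm_num), ← Real.rpow_natCast]; norm_num
  refine Real.sqrt_le_iff.mpr ⟨by positivity, ?_⟩
  calc ∑ t ∈ s, a t ^ 2 ≤ ∑ t ∈ s, |a t| ^ p * (S ^ (1 / p)) ^ (2 - p) := by
        refine Finset.sum_le_sum fun t ht => ?_
        rw [← sq_abs, hsplit _ (abs_nonneg _)]
        have := hroot t ht
        have h2 : 0 ≤ 2 - p := by linarith
        gcongr
    _ = (S ^ (1 / p)) ^ 2 := by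
        rw [← Finset.sum_mul, ← hS, hsplit (S ^ (1 / p)) (by positivity), hR]

lemma sqrt_sum_sq_le_add_sqrt_sum_sq {ι : Type*} (s : Finset ι) (a b : ι → ℝ) :
    √(∑ t ∈ s, a t ^ 2) ≤ √2 * √(∑ t ∈ s, (a t - b t) ^ 2) + √(2 * ∑ t ∈ s, b t ^ 2) := by
  rw [← Real.sqrt_mul zero_le_two]
  refine Real.sqrt_le_iff.mpr ⟨by positivity, ?_⟩
  calc ∑ t ∈ s, a t ^ 2 ≤ 2 * ∑ t ∈ s, (a t - b t) ^ 2 + 2 * ∑ t ∈ s, b t ^ 2 := by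
        rw [Finset.mul_sum, Finset.mul_sum, ← Finset.sum_add_distrib]
        exact Finset.sum_le_sum fun t _ => by nlinarith [sq_nonneg (a t - 2 * b t)]
    _ = √(2 * ∑ t ∈ s, (a t - b t) ^ 2) ^ 2 + √(2 * ∑ t ∈ s, b t ^ 2) ^ 2 := by
        rw [Real.sq_sqrt (by positivity), Real.sq_sqrt (by positivity)]
    _ ≤ _ := by
        rw [add_sq, add_right_comm]
        exact le_add_of_nonneg_right (by positivity)

/-- Jensen's inequality for `y ↦ y ^ (1 / p)`, with integrability of the root. -/
lemma integrable_rpow_inv_and_integral_le {Ω : Type*} [MeasurableSpace Ω] {μ : Measure Ω}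
    [IsProbabilityMeasure μ] {Y : Ω → ℝ} {p : ℝ} (hp : 1 ≤ p) (hY0 : ∀ ω, 0 ≤ Y ω)
    (hY : Integrable Y μ) :
    Integrable (fun ω => Y ω ^ (1 / p)) μ ∧ ∫ ω, Y ω ^ (1 / p) ∂μ ≤ (∫ ω, Y ω ∂μ) ^ (1 / p) := by
  have hp0 : 0 ≤ 1 / p := by positivity
  have hp1 : 1 / p ≤ 1 := (div_le_one (by linarith)).mpr hp
  have hint : Integrable (fun ω => Y ω ^ (1 / p)) μ := by
    refine Integrable.mono' ((integrable_const (1 : ℝ)).add hY)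
      ((Real.continuous_rpow_const hp0).comp_aestronglyMeasurable hY.aestronglyMeasurable)
      (Filter.Eventually.of_forall fun ω => ?_)
    rw [Real.norm_of_nonneg (Real.rpow_nonneg (hY0 ω) _)]
    simp only [Pi.add_apply]
    rcases le_total (Y ω) 1 with h | h
    · linarith [Real.rpow_le_one (hY0 ω) h hp0, hY0 ω]
    · have := Real.rpow_le_rpow_of_exponent_le h hp1
      rw [Real.rpow_one] at this
      linarith
  exact ⟨hint, (Real.concaveOn_rpow hp0 hp1).le_map_integral
    (Real.continuous_rpow_const hp0).continuousOn isClosed_Ici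
    (Filter.Eventually.of_forall hY0) hY hint⟩

/-- Jensen's inequality for `y ↦ log (1 + y² / c²)`, up to the factor two. -/
lemma integral_log_one_add_div_sq_le {Ω : Type*} [MeasurableSpace Ω] {μ : Measure Ω}
    [IsProbabilityMeasure μ] {V : Ω → ℝ} {c B : ℝ} (hc : 0 < c) (hV0 : ∀ ω, 0 ≤ V ω)
    (hV : Integrable (fun ω => √(V ω)) μ) (hB : ∫ ω, √(V ω) ∂μ ≤ B) :
    ∫ ω, Real.log (1 + V ω / c ^ 2) ∂μ ≤ 2 * Real.log (1 + B / c) := by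
  have hB0 : 0 ≤ B := (integral_nonneg fun ω => Real.sqrt_nonneg (V ω)).trans hB
  have hb : 0 < 1 + B / c := by positivity
  have hpoint (ω) : Real.log (1 + V ω / c ^ 2) ≤
      2 * (Real.log (1 + B / c) + ((1 + √(V ω) / c) / (1 + B / c) - 1)) := by
    have ha : 0 < 1 + √(V ω) / c := by positivity
    have hlog : Real.log (1 + √(V ω) / c) ≤
        Real.log (1 + B / c) + ((1 + √(V ω) / c) / (1 + B / c) - 1) := by
      have := Real.log_le_sub_one_of_pos (div_pos ha hb)
      rw [Real.log_div ha.ne' hb.ne'] at this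
      linarith
    have hsq : 1 + V ω / c ^ 2 ≤ (1 + √(V ω) / c) ^ 2 := by
      have : 0 ≤ √(V ω) / c := by positivity
      have h2 : (√(V ω) / c) ^ 2 = V ω / c ^ 2 := by rw [div_pow, Real.sq_sqrt (hV0 ω)]
      nlinarith
    have hpos : 0 < 1 + V ω / c ^ 2 := by have := hV0 ω; positivity
    calc Real.log (1 + V ω / c ^ 2) ≤ Real.log ((1 + √(V ω) / c) ^ 2) := Real.log_le_log hpos hsq
      _ = 2 * Real.log (1 + √(V ω) / c) := by rw [Real.log_pow]; norm_num
      _ ≤ _ := by linarith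
  have hint : Integrable (fun ω => 1 + √(V ω) / c) μ := (integrable_const _).add (hV.div_const c)
  have hint' : Integrable (fun ω => (1 + √(V ω) / c) / (1 + B / c) - 1) μ :=
    (hint.div_const _).sub (integrable_const _)
  have hmean : ∫ ω, (1 + √(V ω) / c) ∂μ ≤ 1 + B / c := by
    rw [integral_add (integrable_const _) (hV.div_const c), integral_div]
    simp only [integral_const, probReal_univ, smul_eq_mul, one_mul]
    gcongr
  calc ∫ ω, Real.log (1 + V ω / c ^ 2) ∂μ
      ≤ ∫ ω, 2 * (Real.log (1 + B / c) + ((1 + √(V ω) / c) / (1 + B / c) - 1)) ∂μ :=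
        integral_mono_of_nonneg
          (Filter.Eventually.of_forall fun ω => Real.log_nonneg
            (by have := hV0 ω; simp only [le_add_iff_nonneg_right]; positivity))
          (((integrable_const _).add hint').const_mul 2) (Filter.Eventually.of_forall hpoint)
    _ = 2 * (Real.log (1 + B / c) + ((∫ ω, (1 + √(V ω) / c) ∂μ) / (1 + B / c) - 1)) := by
        rw [integral_const_mul, integral_add (integrable_const _) hint',
          integral_sub (hint.div_const _) (integrable_const _), integral_div]
        simp
    _ ≤ 2 * Real.log (1 + B / c) := by
        have := (div_le_one hb).mpr hmean
        linarith

lemma natFilt_le {Ω : Type} [m : MeasurableSpace Ω] {d : ℕ}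
    {g : ℕ → Ω → EuclideanSpace ℝ (Fin d)} (hg : ∀ t, Measurable (g t)) (t : ℕ) :
    natFilt g t ≤ m :=
  iSup₂_le fun s _ => (hg s).comap_le

lemma measurable_adaV {Ω : Type} [MeasurableSpace Ω] {d : ℕ}
    {g : ℕ → Ω → EuclideanSpace ℝ (Fin d)} (hg : ∀ t, Measurable (g t)) (t : ℕ) (i : Fin d) :
    Measurable fun ω => adaV g t ω i := by
  unfold adaV
  exact Finset.measurable_sum _ fun s _ =>
    (((EuclideanSpace.proj i).measurable).comp (hg s)).pow_const 2

lemma adaV_nonneg {Ω : Type} {d : ℕ} (g : ℕ → Ω → EuclideanSpace ℝ (Fin d)) (t : ℕ) (ω : Ω)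
    (i : Fin d) : 0 ≤ adaV g t ω i :=
  Finset.sum_nonneg fun _ _ => sq_nonneg _

lemma abs_le_sqrt_adaV {Ω : Type} {d : ℕ} (g : ℕ → Ω → EuclideanSpace ℝ (Fin d)) {t : ℕ}
    (ht : 1 ≤ t) (ω : Ω) (i : Fin d) : |g t ω i| ≤ √(adaV g t ω i) :=
  Real.abs_le_sqrt <| Finset.single_le_sum (f := fun s => (g s ω i) ^ 2)
    (fun _ _ => sq_nonneg _) (Finset.mem_Icc.mpr ⟨ht, le_rfl⟩)

lemma measurable_adagrad_iterate {Ω : Type} [MeasurableSpace Ω] {d : ℕ}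
    {g x : ℕ → Ω → EuclideanSpace ℝ (Fin d)} {x₁ : EuclideanSpace ℝ (Fin d)} {γ lam : ℝ}
    (hg : ∀ t, Measurable (g t)) (hx1 : ∀ ω, x 1 ω = x₁)
    (hxupd : ∀ t, 1 ≤ t → ∀ ω (i : Fin d),
      x (t + 1) ω i = x t ω i - γ * g t ω i / (lam + √(adaV g t ω i)))
    {t : ℕ} (ht : 1 ≤ t) : Measurable (x t) := by
  induction t, ht using Nat.le_induction with
  | base => exact (funext hx1 : x 1 = fun _ => x₁) ▸ measurable_const
  | succ t ht ih =>
    have hcoord : Measurable fun ω i => x (t + 1) ω i := by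
      refine measurable_pi_lambda _ fun i => ?_
      simp only [hxupd t ht]
      exact ((EuclideanSpace.proj i).measurable.comp ih).sub
        ((((EuclideanSpace.proj i).measurable.comp (hg t)).const_mul γ).div
          ((measurable_adaV hg t i).sqrt.const_add lam))
    exact (PiLp.continuous_toLp 2 _).measurable.comp hcoord

lemma abs_adagrad_iterate_sub_le {Ω : Type} {d : ℕ}
    {g x : ℕ → Ω → EuclideanSpace ℝ (Fin d)} {x₁ : EuclideanSpace ℝ (Fin d)} {γ lam : ℝ}
    (hγ : 0 < γ) (hlam : 0 < lam) (hx1 : ∀ ω, x 1 ω = x₁)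
    (hxupd : ∀ t, 1 ≤ t → ∀ ω (i : Fin d),
      x (t + 1) ω i = x t ω i - γ * g t ω i / (lam + √(adaV g t ω i)))
    {t : ℕ} (ht : 1 ≤ t) (ω : Ω) (i : Fin d) : |x t ω i - x₁ i| ≤ γ * t := by
  induction t, ht using Nat.le_induction with
  | base => simp [hx1, hγ.le]
  | succ t ht ih =>
    have hstep : |γ * g t ω i / (lam + √(adaV g t ω i))| ≤ γ := by
      have hden : 0 < lam + √(adaV g t ω i) := by positivity
      rw [abs_div, abs_mul, abs_of_pos hγ, abs_of_pos hden, div_le_iff₀ hden]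
      have := abs_le_sqrt_adaV g ht ω i
      gcongr
      linarith
    rw [hxupd t ht]
    push_cast
    rw [abs_le] at *
    constructor <;> linarith

/-- Along the AdaGrad trajectory the partial derivatives grow at most linearly. -/
lemma abs_partial_adagrad_iterate_le {Ω : Type} {d : ℕ} {f : EuclideanSpace ℝ (Fin d) → ℝ}
    {gradf : EuclideanSpace ℝ (Fin d) → EuclideanSpace ℝ (Fin d)}
    {g x : ℕ → Ω → EuclideanSpace ℝ (Fin d)} {x₁ : EuclideanSpace ℝ (Fin d)} {γ lam : ℝ}
    {L : Fin d → ℝ} (hγ : 0 < γ) (hlam : 0 < lam) (hL : ∀ i, 0 < L i)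
    (hsmooth : ∀ u v : EuclideanSpace ℝ (Fin d),
      |f u - f v - ∑ i, gradf v i * (u i - v i)| ≤ 1 / 2 * ∑ i, L i * (u i - v i) ^ 2)
    (hx1 : ∀ ω, x 1 ω = x₁)
    (hxupd : ∀ t, 1 ≤ t → ∀ ω (i : Fin d),
      x (t + 1) ω i = x t ω i - γ * g t ω i / (lam + √(adaV g t ω i)))
    {t : ℕ} (ht : 1 ≤ t) (ω : Ω) (i : Fin d) :
    |gradf (x t ω) i| ≤
      (⨆ j, |gradf x₁ j|) + γ * √((∑ j, L j) * ⨆ j, L j) * t := by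
  have hLi : L i ≤ ⨆ j, L j := le_ciSup (Set.finite_range L).bddAbove i
  have hGi : |gradf x₁ i| ≤ ⨆ j, |gradf x₁ j| :=
    le_ciSup (f := fun j => |gradf x₁ j|) (Set.finite_range _).bddAbove i
  have hsum0 : 0 ≤ ∑ j, L j := Finset.sum_nonneg fun j _ => (hL j).le
  have hsum : ∑ j, L j * (x t ω j - x₁ j) ^ 2 ≤ (∑ j, L j) * (γ * t) ^ 2 := by
    rw [Finset.sum_mul]
    refine Finset.sum_le_sum fun j _ => mul_le_mul_of_nonneg_left ?_ (hL j).le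
    exact sq_le_sq.mpr ((abs_adagrad_iterate_sub_le hγ hlam hx1 hxupd ht ω j).trans (le_abs_self _))
  have hdiff : |gradf (x t ω) i - gradf x₁ i| ≤ γ * √((∑ j, L j) * ⨆ j, L j) * t := by
    have hsqrt : √((∑ j, L j) * ⨆ j, L j) ^ 2 = (∑ j, L j) * ⨆ j, L j :=
      Real.sq_sqrt (mul_nonneg hsum0 ((hL i).le.trans hLi))
    refine abs_le_of_sq_le_sq ?_ (by positivity)
    calc (gradf (x t ω) i - gradf x₁ i) ^ 2 ≤ L i * ∑ j, L j * (x t ω j - x₁ j) ^ 2 :=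
          sq_partial_sub_le_of_coordinate_smooth hL hsmooth _ _ i
      _ ≤ (⨆ j, L j) * ((∑ j, L j) * (γ * t) ^ 2) := by
          gcongr
          · exact Finset.sum_nonneg fun j _ => mul_nonneg (hL j).le (sq_nonneg _)
          · exact (hL i).le.trans hLi
      _ = (γ * √((∑ j, L j) * ⨆ j, L j) * t) ^ 2 := by
          rw [mul_pow, mul_pow, mul_pow, hsqrt]; ring
  calc |gradf (x t ω) i| = |(gradf (x t ω) i - gradf x₁ i) + gradf x₁ i| := by ring_nf
    _ ≤ _ := abs_add_le _ _
    _ ≤ _ := by linarith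

/-- Accumulated root sum of squares of a sequence with at most linear growth. -/
lemma sqrt_two_mul_sum_sq_le {a : ℕ → ℝ} {T : ℕ} {G M : ℝ} (hG : 0 ≤ G) (hM : 0 ≤ M)
    (ha : ∀ t ∈ Finset.Icc 1 T, |a t| ≤ G + M * t) :
    √(2 * ∑ t ∈ Finset.Icc 1 T, a t ^ 2) ≤
      2 * G * (T : ℝ) ^ ((1 : ℝ) / 2) + 2 * M * (T : ℝ) ^ ((3 : ℝ) / 2) := by
  have hT : (T : ℝ) ^ ((3 : ℝ) / 2) = T * √T := by
    rw [show (3 : ℝ) / 2 = 1 + 1 / 2 by norm_num, Real.rpow_add' (by positivity) (by norm_num),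
      Real.rpow_one, ← Real.sqrt_eq_rpow]
  have hsum : ∑ t ∈ Finset.Icc 1 T, a t ^ 2 ≤ T * (G + M * T) ^ 2 := by
    calc ∑ t ∈ Finset.Icc 1 T, a t ^ 2 ≤ ∑ _t ∈ Finset.Icc 1 T, (G + M * T) ^ 2 := by
          refine Finset.sum_le_sum fun t ht => sq_le_sq.mpr ((ha t ht).trans ?_)
          have : (t : ℝ) ≤ T := by exact_mod_cast (Finset.mem_Icc.mp ht).2
          exact le_trans (by gcongr) (le_abs_self _)
      _ = T * (G + M * T) ^ 2 := by simp
  rw [hT, ← Real.sqrt_eq_rpow]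
  refine Real.sqrt_le_iff.mpr ⟨by positivity, ?_⟩
  have hTT : √(T : ℝ) ^ 2 = T := Real.sq_sqrt (by positivity)
  calc 2 * ∑ t ∈ Finset.Icc 1 T, a t ^ 2 ≤ 4 * (T * (G + M * T) ^ 2) := by
        have : 0 ≤ (T : ℝ) * (G + M * T) ^ 2 := by positivity
        linarith
    _ = (2 * G * √T + 2 * M * (T * √T)) ^ 2 := by
        nth_rewrite 1 [← hTT]; ring

/-- under the coordinate-wise smoothness (A2) and heavy-tailed
noise (A4) assumptions, for every `T ≥ 1` and coordinate `i` the AdaGrad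
iterates satisfy
`E[ln(1 + v_{T,i}/λ²)] ≤ 2 ln(1 + (√2 σ_i T^{1/p} + E[√(2u_{T,i})])/λ) ≤ 2 ln K_T`,
where `u_{T,i} = ∑_{t=1}^T (∇_i f(x_t))²` and
`K_T = 1 + (√2 ‖σ‖_∞ T^{1/p} + 2‖∇f(x₁)‖_∞ T^{1/2} + 2γ√(‖L‖₁‖L‖_∞) T^{3/2})/λ`. -/
theorem adagrad_log_accumulator_bound
    (d : ℕ) (Ω : Type) [MeasurableSpace Ω] (μ : Measure Ω) [IsProbabilityMeasure μ]
    (f : EuclideanSpace ℝ (Fin d) → ℝ)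
    (gradf : EuclideanSpace ℝ (Fin d) → EuclideanSpace ℝ (Fin d))
    (g x : ℕ → Ω → EuclideanSpace ℝ (Fin d)) (x₁ : EuclideanSpace ℝ (Fin d))
    (γ lam p : ℝ) (L σ : Fin d → ℝ)
    (hγ : 0 < γ) (hlam : 0 < lam)
    (hgrad : ∀ y, HasGradientAt f (gradf y) y)
    (hL : ∀ i, 0 < L i)
    (hsmooth : ∀ u v : EuclideanSpace ℝ (Fin d),
      |f u - f v - ∑ i, gradf v i * (u i - v i)| ≤ 1 / 2 * ∑ i, L i * (u i - v i) ^ 2)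
    (hgmeas : ∀ t, Measurable (g t))
    (hx1 : ∀ ω, x 1 ω = x₁)
    (hxupd : ∀ t, 1 ≤ t → ∀ ω (i : Fin d),
      x (t + 1) ω i = x t ω i - γ * g t ω i / (lam + Real.sqrt (adaV g t ω i)))
    (hp1 : 1 < p) (hp2 : p ≤ 2) (hσ : ∀ i, 0 ≤ σ i)
    (hnoise : ∀ t, 1 ≤ t → ∀ i : Fin d,
      Integrable (fun ω => |g t ω i - gradf (x t ω) i| ^ p) μ ∧
      ∀ᵐ ω ∂μ,
        (μ[(fun ω' => |g t ω' i - gradf (x t ω') i| ^ p) | natFilt g (t - 1)]) ω ≤ σ i ^ p) :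
    ∀ T : ℕ, 1 ≤ T → ∀ i : Fin d,
      (∫ ω, Real.log (1 + adaV g T ω i / lam ^ 2) ∂μ) ≤
        2 * Real.log (1 + (Real.sqrt 2 * σ i * (T : ℝ) ^ (1 / p) +
          ∫ ω, Real.sqrt (2 * ∑ t ∈ Finset.Icc 1 T, (gradf (x t ω) i) ^ 2) ∂μ) / lam) ∧
      2 * Real.log (1 + (Real.sqrt 2 * σ i * (T : ℝ) ^ (1 / p) +
          ∫ ω, Real.sqrt (2 * ∑ t ∈ Finset.Icc 1 T, (gradf (x t ω) i) ^ 2) ∂μ) / lam) ≤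
        2 * Real.log (1 + (Real.sqrt 2 * (⨆ j, |σ j|) * (T : ℝ) ^ (1 / p) +
          2 * (⨆ j, |gradf x₁ j|) * (T : ℝ) ^ ((1 : ℝ) / 2) +
          2 * γ * Real.sqrt ((∑ j, L j) * (⨆ j, L j)) * (T : ℝ) ^ ((3 : ℝ) / 2)) / lam) := by
  intro T _ i
  have hσi : σ i ≤ ⨆ j, |σ j| := (le_abs_self _).trans
    (le_ciSup (f := fun j => |σ j|) (Set.finite_range _).bddAbove i)
  have hG0 : 0 ≤ ⨆ j, |gradf x₁ j| := Real.iSup_nonneg fun j => abs_nonneg _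
  have hu (ω) : √(2 * ∑ t ∈ Finset.Icc 1 T, (gradf (x t ω) i) ^ 2) ≤
      2 * (⨆ j, |gradf x₁ j|) * (T : ℝ) ^ ((1 : ℝ) / 2) +
        2 * (γ * √((∑ j, L j) * (⨆ j, L j))) * (T : ℝ) ^ ((3 : ℝ) / 2) :=
    sqrt_two_mul_sum_sq_le hG0 (by positivity) fun t ht =>
      abs_partial_adagrad_iterate_le hγ hlam hL hsmooth hx1 hxupd (Finset.mem_Icc.mp ht).1 ω i
  have hpartial (t) (ht : t ∈ Finset.Icc 1 T) : Measurable fun ω => gradf (x t ω) i :=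
    (continuous_partial_of_coordinate_smooth hL hsmooth i).measurable.comp
      (measurable_adagrad_iterate hgmeas hx1 hxupd (Finset.mem_Icc.mp ht).1)
  have huint : Integrable
      (fun ω => √(2 * ∑ t ∈ Finset.Icc 1 T, (gradf (x t ω) i) ^ 2)) μ := by
    refine Integrable.mono'
      (integrable_const (2 * (⨆ j, |gradf x₁ j|) * (T : ℝ) ^ ((1 : ℝ) / 2) +
        2 * (γ * √((∑ j, L j) * (⨆ j, L j))) * (T : ℝ) ^ ((3 : ℝ) / 2)))
      ((Finset.measurable_sum _ fun t ht =>
        (hpartial t ht).pow_const 2).const_mul 2).sqrt.aestronglyMeasurable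
      (Filter.Eventually.of_forall fun ω => ?_)
    rw [Real.norm_of_nonneg (Real.sqrt_nonneg _)]
    exact hu ω
  have hmoment (t) (ht : t ∈ Finset.Icc 1 T) :
      ∫ ω, |g t ω i - gradf (x t ω) i| ^ p ∂μ ≤ σ i ^ p := by
    rw [← integral_condExp (natFilt_le hgmeas (t - 1))]
    calc _ ≤ ∫ _, σ i ^ p ∂μ := integral_mono_ae integrable_condExp (integrable_const _)
          (hnoise t (Finset.mem_Icc.mp ht).1 i).2
      _ = σ i ^ p := by simp
  have hYint : Integrable
      (fun ω => ∑ t ∈ Finset.Icc 1 T, |g t ω i - gradf (x t ω) i| ^ p) μ :=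
    integrable_finsetSum _ fun t ht => (hnoise t (Finset.mem_Icc.mp ht).1 i).1
  obtain ⟨hrint, hrle⟩ := integrable_rpow_inv_and_integral_le hp1.le
    (fun ω => Finset.sum_nonneg fun t _ => Real.rpow_nonneg (abs_nonneg _) p) hYint
  have hroot : ∫ ω, (∑ t ∈ Finset.Icc 1 T, |g t ω i - gradf (x t ω) i| ^ p) ^ (1 / p) ∂μ ≤
      σ i * (T : ℝ) ^ (1 / p) := by
    refine hrle.trans ?_
    have hσp : (σ i ^ p) ^ (1 / p) = σ i := by
      rw [one_div, Real.rpow_rpow_inv (hσ i) (by linarith)]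
    calc _ ≤ (T * σ i ^ p) ^ (1 / p) := by
          refine Real.rpow_le_rpow (integral_nonneg fun ω => Finset.sum_nonneg fun t _ =>
            Real.rpow_nonneg (abs_nonneg _) p) ?_ (by positivity)
          rw [integral_finsetSum _ fun t ht => (hnoise t (Finset.mem_Icc.mp ht).1 i).1]
          exact (Finset.sum_le_sum hmoment).trans (by simp)
      _ = σ i * (T : ℝ) ^ (1 / p) := by
          rw [Real.mul_rpow (by positivity) (Real.rpow_nonneg (hσ i) p), hσp, mul_comm]
  have hbint := (hrint.const_mul √2).add huint
  have hV (ω) : √(adaV g T ω i) ≤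
      √2 * (∑ t ∈ Finset.Icc 1 T, |g t ω i - gradf (x t ω) i| ^ p) ^ (1 / p) +
        √(2 * ∑ t ∈ Finset.Icc 1 T, (gradf (x t ω) i) ^ 2) :=
    (sqrt_sum_sq_le_add_sqrt_sum_sq _ (fun t => g t ω i) fun t => gradf (x t ω) i).trans
      (by gcongr; exact sqrt_sum_sq_le_rpow_sum_abs_rpow _ _ (by linarith) hp2)
  have hVint : Integrable (fun ω => √(adaV g T ω i)) μ := by
    refine hbint.mono' (measurable_adaV hgmeas T i).sqrt.aestronglyMeasurable
      (Filter.Eventually.of_forall fun ω => ?_)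
    rw [Real.norm_of_nonneg (Real.sqrt_nonneg _)]
    exact hV ω
  refine ⟨integral_log_one_add_div_sq_le hlam (fun ω => adaV_nonneg g T ω i) hVint ?_, ?_⟩
  · refine (integral_mono hVint hbint hV).trans ?_
    simp only [Pi.add_apply]
    rw [integral_add (hrint.const_mul √2) huint, integral_const_mul, mul_assoc]
    gcongr
  · have hE0 : 0 ≤ ∫ ω, √(2 * ∑ t ∈ Finset.Icc 1 T, (gradf (x t ω) i) ^ 2) ∂μ :=
      integral_nonneg fun ω => Real.sqrt_nonneg _
    have hE : ∫ ω, √(2 * ∑ t ∈ Finset.Icc 1 T, (gradf (x t ω) i) ^ 2) ∂μ ≤ _ :=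
      (integral_mono huint (integrable_const _) hu).trans_eq (integral_const _)
    rw [probReal_univ, one_smul] at hE
    have hσi0 := hσ i
    have hσT : √2 * σ i * (T : ℝ) ^ (1 / p) ≤ √2 * (⨆ j, |σ j|) * (T : ℝ) ^ (1 / p) := by gcongr
    refine mul_le_mul_of_nonneg_left (Real.log_le_log (by positivity) ?_) zero_le_two
    refine add_le_add_right (div_le_div_of_nonneg_right ?_ hlam.le) 1
    linarith
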